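/- Let R be an integral domain and C̃ an S-complex over R. Then the Frøyshov invariant of the dual S-complex satisfies h(C̃†) = −h(C̃). -/

import Mathlib

/-!  S-complexes over a commutative ring `R` (following Daemi–Scaduto).

An S-complex is a ℤ-graded finitely generated free chain complex
`C̃ = C ⊕ C[1] ⊕ R` determined by the data of `C` together with maps
`d, v, δ₁, δ₂`.  We encode the graded module `C` by a single module `Tot`
together with an internal ℤ-grading by submodules, and we carry the sign
map `ε` (multiplication by `(-1)^i` on the degree `i` part) as data. -/

universe u

/-- The data of an S-complex over `R`: a module `Tot` (the total module of the
ℤ-graded module `C_*`), its grading, the sign map `ε`, and the structure maps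
`d : C_* → C_{*-1}`, `v : C_* → C_{*-2}`, `δ₁ : C_* → R` (supported in degree 1),
`δ₂ : R → C_{-2}`. -/
structure SComplexData (R : Type u) [CommRing R] where
  Tot : Type u
  [acg : AddCommGroup Tot]
  [mod : Module R Tot]
  grading : ℤ → Submodule R Tot
  sign : Tot →ₗ[R] Tot
  d : Tot →ₗ[R] Tot
  v : Tot →ₗ[R] Tot
  δ₁ : Tot →ₗ[R] R
  δ₂ : R →ₗ[R] Tot

attribute [instance] SComplexData.acg SComplexData.mod

namespace SComplexData

variable {R : Type u} [CommRing R]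

/-- The axioms making the data of `X : SComplexData R` into a genuine S-complex:
the grading is an internal direct sum decomposition into finitely generated free
pieces, the sign map is `(-1)^i` on the degree `i` piece, the structure maps are
graded of the appropriate degrees (`δ₁` supported on `C_1`, `δ₂` valued in `C_{-2}`),
and the S-complex relations `d∘d = 0`, `δ₁∘d = 0`, `d∘δ₂ = 0`,
`d∘v − v∘d − δ₂∘δ₁ = 0` hold; the latter are equivalent to `d̃ ∘ d̃ = 0` for the
differential `d̃(α, β, r) = (dα, vα − dβ + δ₂ r, δ₁ α)` on `C̃ = C ⊕ C[1] ⊕ R`. -/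
structure IsSComplex (X : SComplexData R) : Prop where
  internal : DirectSum.IsInternal X.grading
  free : ∀ i : ℤ, Module.Free R ↥(X.grading i)
  finite : Module.Finite R X.Tot
  sign_spec : ∀ i : ℤ, ∀ x ∈ X.grading i, X.sign x = if Even i then x else -x
  d_deg : ∀ i : ℤ, (X.grading i).map X.d ≤ X.grading (i - 1)
  v_deg : ∀ i : ℤ, (X.grading i).map X.v ≤ X.grading (i - 2)
  δ₁_deg : ∀ i : ℤ, i ≠ 1 → ∀ x ∈ X.grading i, X.δ₁ x = 0
  δ₂_deg : LinearMap.range X.δ₂ ≤ X.grading (-2)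
  d_d : X.d ∘ₗ X.d = 0
  δ₁_d : X.δ₁ ∘ₗ X.d = 0
  d_δ₂ : X.d ∘ₗ X.δ₂ = 0
  d_v : X.d ∘ₗ X.v - X.v ∘ₗ X.d - X.δ₂ ∘ₗ X.δ₁ = 0

/-- A morphism of S-complexes `λ̃ : C̃ → C̃'`, i.e. a degree-0 chain map
`λ̃(α, β, r) = (λ α, μ α + λ β + Δ₂ r, Δ₁ α + r)`, recorded through its
components `λ, μ, Δ₁, Δ₂` (here `l` stands for `λ`). -/
structure SMorphism (X Y : SComplexData R) where
  l : X.Tot →ₗ[R] Y.Tot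
  μ : X.Tot →ₗ[R] Y.Tot
  Δ₁ : X.Tot →ₗ[R] R
  Δ₂ : R →ₗ[R] Y.Tot
  l_deg : ∀ i : ℤ, (X.grading i).map l ≤ Y.grading i
  μ_deg : ∀ i : ℤ, (X.grading i).map μ ≤ Y.grading (i - 1)
  Δ₁_deg : ∀ i : ℤ, i ≠ 0 → ∀ x ∈ X.grading i, Δ₁ x = 0
  Δ₂_deg : LinearMap.range Δ₂ ≤ Y.grading (-1)
  comm_d : l ∘ₗ X.d = Y.d ∘ₗ l
  comm_δ₁ : Δ₁ ∘ₗ X.d + X.δ₁ = Y.δ₁ ∘ₗ l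
  comm_δ₂ : Y.d ∘ₗ Δ₂ + l ∘ₗ X.δ₂ = Y.δ₂
  comm_v : μ ∘ₗ X.d + Y.d ∘ₗ μ + l ∘ₗ X.v - Y.v ∘ₗ l + Δ₂ ∘ₗ X.δ₁ - Y.δ₂ ∘ₗ Δ₁ = 0

end SComplexData

/-- Functions `ℕ → M` with finitely many nonzero values (i.e. support bounded
above); this realizes the polynomial module `M[x]`. -/
def NatBdd (R : Type u) [CommRing R] (M : Type u) [AddCommGroup M] [Module R M] :
    Submodule R (ℕ → M) where
  carrier := {f | ∃ N : ℕ, ∀ n : ℕ, N < n → f n = 0}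
  add_mem' := by
    rintro f g ⟨N, hN⟩ ⟨K, hK⟩
    refine ⟨max N K, fun n hn => ?_⟩
    have h1 := hN n (lt_of_le_of_lt (le_max_left N K) hn)
    have h2 := hK n (lt_of_le_of_lt (le_max_right N K) hn)
    show f n + g n = 0
    rw [h1, h2, add_zero]
  zero_mem' := ⟨0, fun _ _ => rfl⟩
  smul_mem' := by
    rintro c f ⟨N, hN⟩
    refine ⟨N, fun n hn => ?_⟩
    show c • f n = 0
    rw [hN n hn, smul_zero]

/-- Functions `ℤ → M` with support bounded above; for `M = R` this realizes the
ring `R[[x⁻¹, x]]` of Laurent series with finitely many positive powers of `x`. -/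
def IntBdd (R : Type u) [CommRing R] (M : Type u) [AddCommGroup M] [Module R M] :
    Submodule R (ℤ → M) where
  carrier := {f | ∃ N : ℤ, ∀ n : ℤ, N < n → f n = 0}
  add_mem' := by
    rintro f g ⟨N, hN⟩ ⟨K, hK⟩
    refine ⟨max N K, fun n hn => ?_⟩
    have h1 := hN n (lt_of_le_of_lt (le_max_left N K) hn)
    have h2 := hK n (lt_of_le_of_lt (le_max_right N K) hn)
    show f n + g n = 0
    rw [h1, h2, add_zero]
  zero_mem' := ⟨0, fun _ _ => rfl⟩
  smul_mem' := by
    rintro c f ⟨N, hN⟩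
    refine ⟨N, fun n hn => ?_⟩
    show c • f n = 0
    rw [hN n hn, smul_zero]

/-- The multiplication of `R[[x⁻¹, x]]`, realized as a convolution product on
functions `ℤ → R` with support bounded above. -/
noncomputable def lmul {R : Type u} [CommRing R] (f g : ↥(IntBdd R R)) : ↥(IntBdd R R) :=
  ⟨fun n => ∑ᶠ i : ℤ, f.1 i * g.1 (n - i), by
    obtain ⟨N, hN⟩ := f.2
    obtain ⟨K, hK⟩ := g.2
    refine ⟨N + K, fun n hn => ?_⟩
    apply finsum_eq_zero_of_forall_eq_zero
    intro i
    by_cases h : N < i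
    · rw [hN i h, zero_mul]
    · rw [hK (n - i) (by omega), mul_zero]⟩

namespace SComplexData

variable {R : Type u} [CommRing R]

/-- The carrier of the small equivariant complex `𝔣Ĉ_* = C_{*-1} ⊕ R[x]`,
with `R[x]` realized as finitely supported functions `ℕ → R`. -/
abbrev Small (X : SComplexData R) : Type u := X.Tot × ↥(NatBdd R R)

/-- `Σᵢ vⁱ δ₂(aᵢ)` for a polynomial with coefficients `aᵢ`. -/
noncomputable def sumV (X : SComplexData R) (f : ↥(NatBdd R R)) : X.Tot :=
  ∑ᶠ i : ℕ, (X.v ^ i) (X.δ₂ (f.1 i))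

/-- The differential `𝔡̂(α, Σᵢ aᵢxⁱ) = (dα − Σᵢ vⁱδ₂(aᵢ), 0)` of the small
equivariant complex. -/
noncomputable def smallD (X : SComplexData R) : X.Small → X.Small :=
  fun z => (X.d z.1 - X.sumV z.2, 0)

/-- The `R[x]`-module structure of the small equivariant complex:
`x · (α, p(x)) = (v(α), δ₁(α) + x·p(x))`; this is the action of `x`. -/
noncomputable def xSmall (X : SComplexData R) : X.Small → X.Small :=
  fun z => (X.v z.1, ⟨fun n => if n = 0 then X.δ₁ z.1 else z.2.1 (n - 1), by
    obtain ⟨N, hN⟩ := z.2.2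
    refine ⟨N + 1, fun n hn => ?_⟩
    show (if n = 0 then X.δ₁ z.1 else z.2.1 (n - 1)) = 0
    rw [if_neg (by omega)]
    exact hN (n - 1) (by omega)⟩)

/-- The map `𝔦 : 𝔣Ĉ_* → R[[x⁻¹, x]]`,
`𝔦(α, Σᵢ aᵢxⁱ) = Σ_{i ≤ −1} δ₁v^{−i−1}(α) xⁱ + Σᵢ aᵢxⁱ`. -/
noncomputable def iota (X : SComplexData R) : X.Small → ↥(IntBdd R R) :=
  fun z => ⟨fun n => if n < 0 then X.δ₁ ((X.v ^ (-n - 1).toNat) z.1) else z.2.1 n.toNat, by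
    obtain ⟨N, hN⟩ := z.2.2
    refine ⟨(N : ℤ), fun n hn => ?_⟩
    show (if n < 0 then X.δ₁ ((X.v ^ (-n - 1).toNat) z.1) else z.2.1 n.toNat) = 0
    rw [if_neg (by omega)]
    exact hN n.toNat (by omega)⟩

/-- `𝔍(C̃) = 𝔦(ker 𝔡̂)`, an `R[x]`-submodule of `R[[x⁻¹, x]]`, here recorded
as a set. -/
noncomputable def JJ (X : SComplexData R) : Set ↥(IntBdd R R) :=
  X.iota '' {z | X.smallD z = 0}

/-- `DegEq Q n` means that the Laurent series `Q` is nonzero with `Deg Q = n`,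
i.e. `n` is the largest exponent with nonzero coefficient. -/
def DegEq {R : Type u} [CommRing R] (Q : ↥(IntBdd R R)) (n : ℤ) : Prop :=
  Q.1 n ≠ 0 ∧ ∀ m : ℤ, n < m → Q.1 m = 0

/-- The set of degrees of nonzero elements of `𝔍(C̃)`. -/
noncomputable def degSet (X : SComplexData R) : Set ℤ :=
  {n : ℤ | ∃ Q ∈ X.JJ, DegEq Q n}

/-- The Frøyshov invariant `h(C̃) = −inf {Deg Q : 0 ≠ Q ∈ 𝔍(C̃)}`. -/
noncomputable def hInv (X : SComplexData R) : ℤ := -sInf X.degSet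

/-- The ideal `J_i(C̃) = {a ∈ R : ∃ Q = a·x^{−i} + (lower order terms) ∈ 𝔍(C̃)}`,
recorded as a set. -/
noncomputable def Jideal (X : SComplexData R) (i : ℤ) : Set R :=
  {a : R | ∃ Q ∈ X.JJ, (∀ m : ℤ, -i < m → Q.1 m = 0) ∧ Q.1 (-i) = a}

end SComplexData

namespace SComplexData

variable {R : Type u} [CommRing R]

/-- The dual S-complex `C̃†`: its chain module is `C† = Hom_R(C, R)`, graded so
that a functional supported on `C_{-j-1}` has degree `j`, with structure maps
`d†(f) = (−1)^i f∘d` (for `f` supported on `C_i`, implemented globally as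
`f ↦ f ∘ ε ∘ d`), `v†(f) = f∘v`, `δ₁†(f) = f(δ₂ 1)`, `δ₂†(r) = −r • δ₁`. -/
noncomputable def dualS (X : SComplexData R) : SComplexData R where
  Tot := Module.Dual R X.Tot
  grading := fun j =>
    Submodule.dualAnnihilator (⨆ i ∈ {i : ℤ | i ≠ -j - 1}, X.grading i)
  sign := -X.sign.dualMap
  d := (X.sign ∘ₗ X.d).dualMap
  v := X.v.dualMap
  δ₁ := Module.Dual.eval R X.Tot (X.δ₂ 1)
  δ₂ := -LinearMap.toSpanSingleton R (Module.Dual R X.Tot) X.δ₁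

end SComplexData

/-- Fredholm alternative over an integral domain: a functional on a finite free module that
vanishes on the common kernel of finitely many functionals has a nonzero multiple in their span. -/
theorem exists_smul_eq_sum_smul_of_forall_eq_zero {R M ι : Type*} [CommRing R] [IsDomain R]
    [AddCommGroup M] [Module R M] [Module.Free R M] [Module.Finite R M] [Fintype ι]
    (g : ι → Module.Dual R M) (g₀ : Module.Dual R M)
    (H : ∀ x, (∀ i, g i x = 0) → g₀ x = 0) :
    ∃ (c₀ : R) (c : ι → R), c₀ ≠ 0 ∧ c₀ • g₀ = ∑ i, c i • g i := by
  classical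
  let K := FractionRing R
  let b := Module.Free.chooseBasis R M
  let ext : Module.Dual R M → Module.Dual K (Module.Free.ChooseBasisIndex R M → K) := fun f =>
    ∑ j, algebraMap R K (f (b j)) • LinearMap.proj j
  have ext_apply : ∀ f y, ext f y = ∑ j, algebraMap R K (f (b j)) * y j := by
    intro f y
    simp only [ext, LinearMap.sum_apply, LinearMap.smul_apply, LinearMap.proj_apply, smul_eq_mul]
  have ext_single : ∀ f j, ext f (Pi.single j 1) = algebraMap R K (f (b j)) := by
    intro f j
    simp [ext_apply, Pi.single_apply]
  have hmem : ext g₀ ∈ Submodule.span K (Set.range fun i => ext (g i)) := by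
    apply mem_span_of_iInf_ker_le_ker
    intro y hy
    obtain ⟨s, hs⟩ := IsLocalization.exist_integer_multiples_of_finite (nonZeroDivisors R) y
    choose y' hy' using hs
    have key : ∀ f : Module.Dual R M,
        algebraMap R K (f (∑ j, y' j • b j)) = algebraMap R K s * ext f y := by
      intro f
      rw [ext_apply, Finset.mul_sum, map_sum, map_sum]
      refine Finset.sum_congr rfl fun j _ => ?_
      rw [map_smul, smul_eq_mul, map_mul, hy' j, Algebra.smul_def]
      ring
    have hs0 : algebraMap R K s ≠ 0 :=
      IsFractionRing.to_map_ne_zero_of_mem_nonZeroDivisors s.2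
    have h0 := H (∑ j, y' j • b j) fun i => by
      apply IsFractionRing.injective R K
      have hyi : ext (g i) y = 0 := by
        simpa using (Submodule.mem_iInf _).1 hy i
      rw [key, hyi, mul_zero, map_zero]
    have h1 := key g₀
    rw [h0, map_zero] at h1
    exact (mul_eq_zero.1 h1.symm).resolve_left hs0
  obtain ⟨k, hk⟩ := (Submodule.mem_span_range_iff_exists_fun K).1 hmem
  obtain ⟨s, hs⟩ := IsLocalization.exist_integer_multiples_of_finite (nonZeroDivisors R) k
  choose c hc using hs
  refine ⟨s, c, nonZeroDivisors.ne_zero s.2, b.ext fun j => ?_⟩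
  apply IsFractionRing.injective R K
  have h1 := congrArg (fun f => algebraMap R K s * f (Pi.single j 1)) hk
  simp only [LinearMap.sum_apply, LinearMap.smul_apply, ext_single, smul_eq_mul] at h1
  simp only [LinearMap.sum_apply, LinearMap.smul_apply, smul_eq_mul, map_sum, map_mul]
  rw [← h1, Finset.mul_sum]
  refine Finset.sum_congr rfl fun i _ => ?_
  rw [hc i, Algebra.smul_def]
  ring

/-- The Fredholm alternative for a finite family of functionals extended by an initial segment of
a sequence of functionals. -/
theorem exists_sum_range_smul_eq_sum_smul {R M κ : Type*} [CommRing R] [IsDomain R]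
    [AddCommGroup M] [Module R M] [Module.Free R M] [Module.Finite R M] [Fintype κ]
    (g : κ → Module.Dual R M) (f : ℕ → Module.Dual R M) (k : ℕ)
    (H : ∀ x, (∀ i, g i x = 0) → (∀ i < k, f i x = 0) → f k x = 0) :
    ∃ (a : ℕ → R) (c : κ → R), a k ≠ 0 ∧
      ∑ i ∈ Finset.range (k + 1), a i • f i = ∑ j, c j • g j := by
  obtain ⟨c₀, c, hc₀, hc⟩ := exists_smul_eq_sum_smul_of_forall_eq_zero
    (Sum.elim g fun i : Fin k => f i) (f k)
    (fun x hx => H x (fun i => hx (Sum.inl i)) fun i hi => hx (Sum.inr ⟨i, hi⟩))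
  refine ⟨fun i => if h : i < k then -c (Sum.inr ⟨i, h⟩) else c₀, fun j => c (Sum.inl j),
    by simpa using hc₀, ?_⟩
  rw [Finset.sum_range_succ, Finset.sum_range]
  have hneg : ∑ i : Fin k, -c (Sum.inr i) • f i = -∑ i : Fin k, c (Sum.inr i) • f i := by
    ext x
    simp
  simp only [lt_irrefl, dite_false, hc, Fintype.sum_sum_type, Sum.elim_inl, Sum.elim_inr,
    Fin.is_lt, dite_true, Fin.eta]
  rw [hneg]
  abel

namespace SComplexData

variable {R : Type u} [CommRing R]

theorem sumV_eq_sum_range (X : SComplexData R) (f : ↥(NatBdd R R)) (N : ℕ)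
    (hf : ∀ n, N ≤ n → f.1 n = 0) :
    X.sumV f = ∑ i ∈ Finset.range N, (X.v ^ i) (X.δ₂ (f.1 i)) := by
  apply finsum_eq_sum_of_support_subset
  intro i hi
  by_contra h
  apply hi
  simp [hf i (by simpa using h)]

theorem iota_natCast (X : SComplexData R) (z : X.Small) (i : ℕ) :
    (X.iota z).1 (i : ℤ) = z.2.1 i :=
  rfl

theorem iota_negSucc (X : SComplexData R) (z : X.Small) (i : ℕ) :
    (X.iota z).1 (Int.negSucc i) = X.δ₁ ((X.v ^ i) z.1) := by
  have h1 : (-Int.negSucc i - 1).toNat = i := by omega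
  simp only [iota, if_pos (Int.negSucc_lt_zero i), h1]

theorem natCast_mem_degSet_iff (X : SComplexData R) (k : ℕ) :
    (k : ℤ) ∈ X.degSet ↔ ∃ (α : X.Tot) (a : ℕ → R), a k ≠ 0 ∧
      X.d α = ∑ i ∈ Finset.range (k + 1), (X.v ^ i) (X.δ₂ (a i)) := by
  constructor
  · rintro ⟨_, ⟨⟨α, p⟩, hz, rfl⟩, h0, h1⟩
    refine ⟨α, p.1, h0, ?_⟩
    have hp : ∀ n, k + 1 ≤ n → p.1 n = 0 := fun n hn => h1 n (by omega)
    rw [← X.sumV_eq_sum_range p _ hp]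
    exact sub_eq_zero.1 (congrArg Prod.fst hz)
  · rintro ⟨α, a, ha, hd⟩
    let p : ↥(NatBdd R R) := ⟨fun n => if n ≤ k then a n else 0, k, fun n hn => by simp [hn]⟩
    refine ⟨_, ⟨(α, p), ?_, rfl⟩, by simpa [iota_natCast, p] using ha, fun m hm => ?_⟩
    · refine Prod.ext (sub_eq_zero.2 ?_) rfl
      rw [X.sumV_eq_sum_range p (k + 1) fun n hn => if_neg (by omega)]
      refine hd.trans (Finset.sum_congr rfl fun i hi => ?_)
      have : i ≤ k := by simpa [Nat.lt_succ_iff] using hi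
      simp [p, this]
    · lift m to ℕ using by omega
      exact if_neg (by omega)

theorem negSucc_mem_degSet_iff (X : SComplexData R) (k : ℕ) :
    Int.negSucc k ∈ X.degSet ↔ ∃ α : X.Tot, X.d α = 0 ∧
      (∀ i < k, X.δ₁ ((X.v ^ i) α) = 0) ∧ X.δ₁ ((X.v ^ k) α) ≠ 0 := by
  constructor
  · rintro ⟨_, ⟨⟨α, p⟩, hz, rfl⟩, h0, h1⟩
    have hp : ∀ n, 0 ≤ n → p.1 n = 0 := fun n _ => h1 n (by omega)
    refine ⟨α, ?_, fun i hi => ?_, by rwa [iota_negSucc] at h0⟩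
    · have h := sub_eq_zero.1 (congrArg Prod.fst hz)
      rwa [X.sumV_eq_sum_range p 0 hp, Finset.sum_range_zero] at h
    · rw [← h1 (Int.negSucc i) (by omega), iota_negSucc]
  · rintro ⟨α, hd, hlt, hk⟩
    refine ⟨_, ⟨(α, 0), ?_, rfl⟩, by rwa [iota_negSucc], fun m hm => ?_⟩
    · refine Prod.ext (sub_eq_zero.2 ?_) rfl
      rw [X.sumV_eq_sum_range 0 0 fun _ _ => rfl]
      exact hd
    · cases m with
      | ofNat n => rfl
      | negSucc i => rw [iota_negSucc]; exact hlt i (by omega)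

namespace IsSComplex

variable {X : SComplexData R}

theorem free_tot (hX : X.IsSComplex) : Module.Free R X.Tot := by
  have := hX.free
  exact Module.Free.of_equiv (LinearEquiv.ofBijective (DirectSum.coeLinearMap X.grading) hX.internal)

theorem d_v_apply (hX : X.IsSComplex) (α : X.Tot) :
    X.d (X.v α) = X.v (X.d α) + X.δ₂ (X.δ₁ α) := by
  have h := LinearMap.congr_fun hX.d_v α
  simp only [LinearMap.sub_apply, LinearMap.comp_apply, LinearMap.zero_apply] at h
  rw [sub_sub, sub_eq_zero] at h
  exact h

theorem sign_sign (hX : X.IsSComplex) : X.sign ∘ₗ X.sign = LinearMap.id := by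
  ext α
  have hα : α ∈ ⨆ i, X.grading i := by
    rw [hX.internal.submodule_iSup_eq_top]
    trivial
  induction hα using Submodule.iSup_induction' with
  | mem i x hx =>
    have h := hX.sign_spec i x hx
    by_cases hi : Even i <;> simp_all
  | zero => simp
  | add x y _ _ hx hy => simpa using congrArg₂ (· + ·) hx hy

theorem sign_v_pow_δ₂ (hX : X.IsSComplex) (i : ℕ) (r : R) :
    X.sign ((X.v ^ i) (X.δ₂ r)) = (X.v ^ i) (X.δ₂ r) := by
  have hmem : (X.v ^ i) (X.δ₂ r) ∈ X.grading (-2 - 2 * i) := by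
    induction i with
    | zero => simpa using hX.δ₂_deg ⟨r, rfl⟩
    | succ i ih =>
      have h := hX.v_deg _ ⟨_, ih, rfl⟩
      rw [pow_succ', Module.End.mul_apply]
      convert h using 2
      push_cast
      ring
  rw [hX.sign_spec _ _ hmem, if_pos]
  exact ⟨-1 - i, by ring⟩

theorem add_one_mem_degSet (hX : X.IsSComplex) {n : ℤ} (hn : n ∈ X.degSet) :
    n + 1 ∈ X.degSet := by
  cases n with
  | ofNat k =>
    obtain ⟨α, a, ha, hd⟩ := (X.natCast_mem_degSet_iff k).1 hn
    refine (X.natCast_mem_degSet_iff (k + 1)).2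
      ⟨X.v α, fun i => Nat.casesOn i (X.δ₁ α) a, ha, ?_⟩
    rw [hX.d_v_apply, hd, map_sum, Finset.sum_range_succ' _ (k + 1)]
    simp [pow_succ']
  | negSucc k =>
    obtain ⟨α, hd, hlt, hk⟩ := (X.negSucc_mem_degSet_iff k).1 hn
    cases k with
    | zero =>
      refine (X.natCast_mem_degSet_iff 0).2 ⟨X.v α, fun _ => X.δ₁ α, hk, ?_⟩
      simp [hX.d_v_apply, hd]
    | succ k =>
      have h0 : X.δ₁ α = 0 := hlt 0 (Nat.succ_pos k)
      refine (X.negSucc_mem_degSet_iff k).2 ⟨X.v α, ?_, fun i hi => ?_, ?_⟩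
      · simp [hX.d_v_apply, hd, h0]
      · simpa [pow_succ] using hlt (i + 1) (by omega)
      · simpa [pow_succ] using hk

theorem mem_degSet_of_le (hX : X.IsSComplex) {m n : ℤ} (hm : m ∈ X.degSet) (hmn : m ≤ n) :
    n ∈ X.degSet := by
  induction n, hmn using Int.leInduction with
  | base => exact hm
  | succ n _ ih => exact hX.add_one_mem_degSet ih

theorem exists_mem_degSet_and_notMem_degSet [Nontrivial R] (hX : X.IsSComplex) :
    ∃ k : ℕ, (k : ℤ) ∈ X.degSet ∧ Int.negSucc k ∉ X.degSet := by
  have := hX.free_tot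
  have := hX.finite
  have hmonic := X.v.charpoly_monic
  have hzero := X.v.aeval_self_charpoly
  rw [Polynomial.aeval_eq_sum_range] at hzero
  refine ⟨X.v.charpoly.natDegree, ?_, ?_⟩
  · refine (X.natCast_mem_degSet_iff _).2 ⟨0, X.v.charpoly.coeff, ?_, ?_⟩
    · simp [hmonic]
    · have h := LinearMap.congr_fun hzero (X.δ₂ 1)
      rw [LinearMap.sum_apply, LinearMap.zero_apply] at h
      rw [map_zero, ← h]
      refine Finset.sum_congr rfl fun i _ => ?_
      rw [LinearMap.smul_apply, ← map_smul, ← map_smul, smul_eq_mul, mul_one]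
  · intro h
    obtain ⟨α, -, hlt, hk⟩ := (X.negSucc_mem_degSet_iff _).1 h
    have h := congrArg X.δ₁ (LinearMap.congr_fun hzero α)
    rw [Finset.sum_range_succ, Polynomial.coeff_natDegree, hmonic.leadingCoeff, one_smul,
      LinearMap.add_apply, map_add, LinearMap.sum_apply, map_sum, Finset.sum_eq_zero, zero_add,
      LinearMap.zero_apply, map_zero] at h
    · exact hk h
    · intro i hi
      rw [LinearMap.smul_apply, map_smul, hlt i (Finset.mem_range.1 hi), smul_zero]

end IsSComplex

theorem dualMap_pow_apply (X : SComplexData R) (i : ℕ) (f : Module.Dual R X.Tot) :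
    (X.v.dualMap ^ i) f = f ∘ₗ (X.v ^ i) := by
  induction i with
  | zero => rfl
  | succ i ih =>
    rw [pow_succ', Module.End.mul_apply, ih, pow_succ]
    rfl

theorem natCast_mem_degSet_dualS_iff_exists (X : SComplexData R) (k : ℕ) :
    (k : ℤ) ∈ (dualS X).degSet ↔ ∃ (f : Module.Dual R X.Tot) (a : ℕ → R), a k ≠ 0 ∧
      f ∘ₗ X.sign ∘ₗ X.d = -∑ i ∈ Finset.range (k + 1), a i • (X.δ₁ ∘ₗ (X.v ^ i)) := by
  have hsum : ∀ a : ℕ → R,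
      ∑ i ∈ Finset.range (k + 1),
        (X.v.dualMap ^ i) ((-LinearMap.toSpanSingleton R (Module.Dual R X.Tot) X.δ₁) (a i)) =
      -∑ i ∈ Finset.range (k + 1), a i • (X.δ₁ ∘ₗ (X.v ^ i)) := by
    intro a
    rw [← Finset.sum_neg_distrib]
    refine Finset.sum_congr rfl fun i _ => ?_
    rw [dualMap_pow_apply]
    rfl
  rw [natCast_mem_degSet_iff]
  exact exists_congr fun f => exists_congr fun a => and_congr_right fun _ =>
    ⟨fun h => Eq.trans h (hsum a), fun h => Eq.trans h (hsum a).symm⟩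

theorem negSucc_mem_degSet_dualS_iff_exists (X : SComplexData R) (k : ℕ) :
    Int.negSucc k ∈ (dualS X).degSet ↔ ∃ f : Module.Dual R X.Tot, f ∘ₗ X.sign ∘ₗ X.d = 0 ∧
      (∀ i < k, f ((X.v ^ i) (X.δ₂ 1)) = 0) ∧ f ((X.v ^ k) (X.δ₂ 1)) ≠ 0 := by
  have hv : ∀ (i : ℕ) (f : Module.Dual R X.Tot),
      (dualS X).δ₁ (((dualS X).v ^ i) f) = f ((X.v ^ i) (X.δ₂ 1)) := fun i f =>
    LinearMap.congr_fun (X.dualMap_pow_apply i f) (X.δ₂ 1)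
  rw [negSucc_mem_degSet_iff]
  exact exists_congr fun f => and_congr Iff.rfl <| and_congr
    (forall₂_congr fun i _ => Eq.congr_left (hv i f)) (not_congr (Eq.congr_left (hv k f)))

theorem v_pow_δ₂_eq_smul (X : SComplexData R) (i : ℕ) (r : R) :
    (X.v ^ i) (X.δ₂ r) = r • (X.v ^ i) (X.δ₂ 1) := by
  rw [← map_smul, ← map_smul, smul_eq_mul, mul_one]

namespace IsSComplex

variable [IsDomain R] {X : SComplexData R}

theorem negSucc_mem_degSet_dualS_iff (hX : X.IsSComplex) (k : ℕ) :
    Int.negSucc k ∈ (dualS X).degSet ↔ (k : ℤ) ∉ X.degSet := by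
  have := hX.free_tot
  have := hX.finite
  rw [negSucc_mem_degSet_dualS_iff_exists, natCast_mem_degSet_iff]
  constructor
  · rintro ⟨f, hf, hlt, hk⟩ ⟨α, a, ha, hd⟩
    have h : f (X.sign (X.d α)) = 0 := LinearMap.congr_fun hf α
    rw [hd, map_sum, Finset.sum_congr rfl fun i _ => hX.sign_v_pow_δ₂ i (a i), map_sum,
      Finset.sum_range_succ, Finset.sum_eq_zero, zero_add, v_pow_δ₂_eq_smul, map_smul,
      smul_eq_mul] at h
    · exact mul_ne_zero ha hk h
    · intro i hi
      rw [v_pow_δ₂_eq_smul, map_smul, hlt i (Finset.mem_range.1 hi), smul_zero]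
  · intro hno
    by_contra hno'
    apply hno
    let b := Module.Free.chooseBasis R X.Tot
    obtain ⟨a, c, ha, h⟩ := exists_sum_range_smul_eq_sum_smul
      (fun j => Module.Dual.eval R X.Tot (X.d (b j)))
      (fun i => Module.Dual.eval R X.Tot ((X.v ^ i) (X.δ₂ 1))) k (by
        intro f hf hlt
        by_contra hk
        refine hno' ⟨f ∘ₗ X.sign, ?_, fun i hi => ?_, ?_⟩
        · have : f ∘ₗ X.d = 0 := b.ext hf
          change f ∘ₗ X.sign ∘ₗ X.sign ∘ₗ X.d = 0
          rw [← LinearMap.comp_assoc X.d, hX.sign_sign, LinearMap.id_comp, this]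
        · simpa [hX.sign_v_pow_δ₂] using hlt i hi
        · simpa [hX.sign_v_pow_δ₂] using hk)
    refine ⟨∑ j, c j • b j, a, ha, ?_⟩
    simp only [← map_smul (Module.Dual.eval R X.Tot), ← map_sum] at h
    rw [map_sum, Finset.sum_congr rfl fun j _ => map_smul X.d (c j) (b j), ← b.eval_injective h]
    exact Finset.sum_congr rfl fun i _ => (v_pow_δ₂_eq_smul X i (a i)).symm

theorem natCast_mem_degSet_dualS_iff (hX : X.IsSComplex) (k : ℕ) :
    (k : ℤ) ∈ (dualS X).degSet ↔ Int.negSucc k ∉ X.degSet := by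
  have := hX.free_tot
  have := hX.finite
  rw [negSucc_mem_degSet_iff, natCast_mem_degSet_dualS_iff_exists]
  constructor
  · rintro ⟨f, a, ha, hf⟩ ⟨α, hd, hlt, hk⟩
    have h : f (X.sign (X.d α)) =
        (-∑ i ∈ Finset.range (k + 1), a i • (X.δ₁ ∘ₗ (X.v ^ i))) α :=
      LinearMap.congr_fun hf α
    rw [hd, map_zero, map_zero, LinearMap.neg_apply, LinearMap.sum_apply, Finset.sum_range_succ,
      Finset.sum_eq_zero, zero_add] at h
    · exact mul_ne_zero ha hk (neg_eq_zero.1 h.symm)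
    · intro i hi
      simp [hlt i (Finset.mem_range.1 hi)]
  · intro hno
    let b := Module.Free.chooseBasis R X.Tot
    obtain ⟨a, c, ha, h⟩ := exists_sum_range_smul_eq_sum_smul
      (fun j => b.coord j ∘ₗ X.d) (fun i => X.δ₁ ∘ₗ (X.v ^ i)) k (by
        intro α hα hlt
        by_contra hk
        exact hno ⟨α, b.ext_elem fun j => by simpa using hα j, hlt, hk⟩)
    refine ⟨-((∑ j, c j • b.coord j) ∘ₗ X.sign), a, ha, ?_⟩
    have hd : (-((∑ j, c j • b.coord j) ∘ₗ X.sign)) ∘ₗ X.sign ∘ₗ X.d =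
        -((∑ j, c j • b.coord j) ∘ₗ (X.sign ∘ₗ X.sign) ∘ₗ X.d) := rfl
    rw [hd, hX.sign_sign, LinearMap.id_comp, h]
    ext α
    simp

/-- The degrees attained in the dual are exactly the reflections of those not attained. -/
theorem mem_degSet_dualS_iff (hX : X.IsSComplex) (n : ℤ) :
    n ∈ (dualS X).degSet ↔ -1 - n ∉ X.degSet := by
  cases n with
  | ofNat k =>
    have h : -1 - (Int.ofNat k) = Int.negSucc k := by
      rw [Int.ofNat_eq_natCast]
      omega
    rw [h]
    exact hX.natCast_mem_degSet_dualS_iff k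
  | negSucc k =>
    have h : -1 - (Int.negSucc k) = (k : ℤ) := by omega
    rw [h]
    exact hX.negSucc_mem_degSet_dualS_iff k

end IsSComplex

end SComplexData

open SComplexData in
/-- **Statement 4.** For an S-complex over an integral domain, the Frøyshov
invariant of the dual S-complex satisfies `h(C̃†) = −h(C̃)`. -/
theorem statement4 {R : Type u} [CommRing R] [IsDomain R]
    (A : SComplexData R) (hA : A.IsSComplex) :
    (dualS A).hInv = -A.hInv := by
  obtain ⟨k, hk, hk'⟩ := hA.exists_mem_degSet_and_notMem_degSet
  have hbdd : BddBelow A.degSet :=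
    ⟨Int.negSucc k, fun n hn => le_of_not_ge fun h => hk' (hA.mem_degSet_of_le hn h)⟩
  have hmem : sInf A.degSet ∈ A.degSet := Int.csInf_mem ⟨k, hk⟩ hbdd
  have hleast : IsLeast (dualS A).degSet (-sInf A.degSet) := by
    constructor
    · rw [hA.mem_degSet_dualS_iff]
      intro h
      have := csInf_le hbdd h
      omega
    · intro n hn
      by_contra hlt
      exact (hA.mem_degSet_dualS_iff n).1 hn (hA.mem_degSet_of_le hmem (by omega))
  rw [hInv, hInv, hleast.csInf_eq]
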